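/- arXiv:1812.04050 — 2 statements merged into one kernel-verified Lean document; each statement's English description precedes it below -/
import Mathlib

section
/- For every n ≥ 2, the DFA P_n is synchronizing, its switch count equals its minimal synchronizing word length, and both are equal to (n² − n)/2. -/
/-- The state reached from `q` after reading the word `w`. -/
def actWord {Q σ : Type*} (δ : Q → σ → Q) (q : Q) (w : List σ) : Q :=
  w.foldl δ q

/-- A word `w` is synchronizing for the DFA with transition function `δ`:
starting in any state, after processing `w` one always ends in the same state. -/
def IsSyncWord {Q σ : Type*} (δ : Q → σ → Q) (w : List σ) : Prop :=
  ∃ qs : Q, ∀ q : Q, actWord δ q w = qs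

/-- The switch count of a word: the number of maximal blocks of consecutive
equal symbols. -/
def swc {σ : Type*} [DecidableEq σ] : List σ → ℕ
  | [] => 0
  | [_] => 1
  | a :: b :: w => (if a = b then 0 else 1) + swc (b :: w)

/-- The switch count of a synchronizing automaton: the minimal switch count of a
synchronizing word. -/
noncomputable def swOf {Q σ : Type*} [DecidableEq σ] (δ : Q → σ → Q) : ℕ :=
  sInf {k | ∃ w : List σ, IsSyncWord δ w ∧ swc w = k}

/-- The minimal length of a synchronizing word. -/
noncomputable def sslOf {Q σ : Type*} (δ : Q → σ → Q) : ℕ :=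
  sInf {k | ∃ w : List σ, IsSyncWord δ w ∧ w.length = k}

/-- The automaton `P_n`: states `{1,…,n}` (encoded as `Fin n`, state `i` being
`⟨i-1, _⟩`) and symbols `a_1,…,a_{n-1}` (encoded as `Fin (n-1)`, symbol `a_i`
being `⟨i-1, _⟩`), where `a_1` maps `2` to `1` and fixes everything else, and
`a_i` (for `i ≥ 2`) swaps `i` and `i+1` and fixes everything else. -/
def Pstep (n : ℕ) : Fin n → Fin (n - 1) → Fin n := fun q s =>
  if (s : ℕ) + 1 = 1 then
    (if (q : ℕ) + 1 = 2 then ⟨0, by have := q.isLt; omega⟩ else q)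
  else if (q : ℕ) + 1 = (s : ℕ) + 1 then ⟨(s : ℕ) + 1, by have := s.isLt; omega⟩
  else if (q : ℕ) + 1 = (s : ℕ) + 2 then ⟨(s : ℕ), by have := s.isLt; omega⟩
  else q

theorem actWord_cons {Q σ : Type*} (δ : Q → σ → Q) (q : Q) (a : σ) (w : List σ) :
    actWord δ q (a :: w) = actWord δ (δ q a) w := rfl

theorem actWord_append {Q σ : Type*} (δ : Q → σ → Q) (q : Q) (u w : List σ) :
    actWord δ q (u ++ w) = actWord δ (actWord δ q u) w :=
  List.foldl_append

theorem swc_le_length {σ : Type*} [DecidableEq σ] : ∀ w : List σ, swc w ≤ w.length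
  | [] => le_rfl
  | [_] => le_rfl
  | a :: b :: w => by
    have := swc_le_length (b :: w)
    simp only [swc, List.length_cons] at *
    split_ifs <;> omega

theorem swc_le_swc_cons {σ : Type*} [DecidableEq σ] (a : σ) : ∀ w : List σ, swc w ≤ swc (a :: w)
  | [] => Nat.zero_le _
  | b :: w => by simp only [swc]; omega

theorem Pstep_val (n : ℕ) (q : Fin n) (s : Fin (n - 1)) :
    (Pstep n q s : ℕ) = if (q : ℕ) = s + 1 then (s : ℕ)
      else if (q : ℕ) = s ∧ (s : ℕ) ≠ 0 then s + 1 else q := by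
  unfold Pstep
  split_ifs <;> simp_all

theorem Pstep_Pstep_of_ne_zero {n : ℕ} (q : Fin n) {s : Fin (n - 1)} (hs : (s : ℕ) ≠ 0) :
    Pstep n (Pstep n q s) s = q := by
  apply Fin.ext
  simp only [Pstep_val]
  split_ifs <;> omega

theorem Pstep_Pstep_of_eq_zero {n : ℕ} (q : Fin n) {s : Fin (n - 1)} (hs : (s : ℕ) = 0) :
    Pstep n (Pstep n q s) s = Pstep n q s := by
  apply Fin.ext
  simp only [Pstep_val]
  split_ifs <;> omega

/-- One letter lowers the sum of the elements of a set of states by at most one. -/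
theorem sum_le_sum_image_Pstep (n : ℕ) (S : Finset (Fin n)) (s : Fin (n - 1)) :
    ∑ q ∈ S, (q : ℕ) ≤ 1 + ∑ q ∈ S.image (Pstep n · s), (q : ℕ) := by
  rw [Finset.sum_image_of_pairwise_eq_zero]
  · calc ∑ q ∈ S, (q : ℕ)
        ≤ ∑ q ∈ S, ((if q = ⟨s + 1, by omega⟩ then 1 else 0) + (Pstep n q s : ℕ)) := by
          refine Finset.sum_le_sum fun q _ => ?_
          simp only [Pstep_val, Fin.ext_iff]
          split_ifs <;> omega
      _ ≤ _ := by
          rw [Finset.sum_add_distrib, Finset.sum_ite_eq']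
          gcongr
          split_ifs <;> omega
  · intro p _ q _ hpq h
    replace h := congrArg Fin.val h
    have hne : (p : ℕ) ≠ q := fun h => hpq (Fin.ext h)
    simp only [Pstep_val] at h ⊢
    split_ifs at h ⊢ <;> omega

/-- A word lowers the sum of the elements of a set of states by at most its switch count. -/
theorem sum_le_swc_add_sum_image (n : ℕ) : ∀ (w : List (Fin (n - 1))) (S : Finset (Fin n)),
    ∑ q ∈ S, (q : ℕ) ≤ swc w + ∑ q ∈ S.image (actWord (Pstep n) · w), (q : ℕ)
  | [], S => by simp [actWord, swc]
  | [a], S => sum_le_sum_image_Pstep n S a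
  | a :: b :: w, S => by
    by_cases hab : a = b
    · subst hab
      have hs : swc (a :: a :: w) = swc (a :: w) := by simp [swc]
      rw [hs]
      by_cases ha : (a : ℕ) = 0
      · simpa only [actWord_cons, Pstep_Pstep_of_eq_zero _ ha] using
          sum_le_swc_add_sum_image n (a :: w) S
      · simp only [actWord_cons, Pstep_Pstep_of_ne_zero _ ha]
        exact (sum_le_swc_add_sum_image n w S).trans
          (Nat.add_le_add_right (swc_le_swc_cons a w) _)
    · have h₁ := sum_le_sum_image_Pstep n S a
      have h₂ := sum_le_swc_add_sum_image n (b :: w) (S.image (Pstep n · a))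
      rw [Finset.image_image] at h₂
      have hs : swc (a :: b :: w) = 1 + swc (b :: w) := by simp [swc, hab]
      rw [hs, add_assoc]
      exact h₁.trans (Nat.add_le_add_left h₂ 1)

theorem actWord_Pstep_zero {n : ℕ} (w : List (Fin (n - 1))) (q : Fin n) (hq : (q : ℕ) = 0) :
    actWord (Pstep n) q w = q := by
  induction w with
  | nil => rfl
  | cons a w ih =>
    have : Pstep n q a = q := by
      apply Fin.ext
      simp only [Pstep_val]
      split_ifs <;> omega
    rw [actWord_cons, this, ih]

theorem le_swc_of_isSyncWord {n : ℕ} (hn : 0 < n) {w : List (Fin (n - 1))}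
    (hw : IsSyncWord (Pstep n) w) : (n ^ 2 - n) / 2 ≤ swc w := by
  obtain ⟨p, hp⟩ := hw
  have h := sum_le_swc_add_sum_image n w Finset.univ
  have hp0 : (p : ℕ) = 0 := by
    rw [← hp ⟨0, hn⟩, actWord_Pstep_zero w _ rfl]
  have h0 : ∑ q ∈ Finset.univ.image (actWord (Pstep n) · w), (q : ℕ) = 0 := by
    refine Finset.sum_eq_zero fun q hq => ?_
    obtain ⟨r, -, rfl⟩ := Finset.mem_image.1 hq
    rw [hp, hp0]
  rw [h0, add_zero, Fin.sum_univ_eq_sum_range (fun i => i), Finset.sum_range_id,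
    Nat.mul_sub_one, ← sq] at h
  exact h

/-- Some word of length `k + 1` takes state `k + 1` to `0` and fixes all larger states. -/
theorem exists_word_succ_to_zero {n : ℕ} (k : ℕ) (hk : k < n - 1) :
    ∃ u : List (Fin (n - 1)), u.length = k + 1 ∧
      (∀ q : Fin n, (q : ℕ) = k + 1 → ((actWord (Pstep n) q u : Fin n) : ℕ) = 0) ∧
      ∀ q : Fin n, k + 1 < (q : ℕ) → actWord (Pstep n) q u = q := by
  have hfix : ∀ q : Fin n, k + 1 < (q : ℕ) → Pstep n q ⟨k, hk⟩ = q := fun q hq => by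
    apply Fin.ext
    simp only [Pstep_val]
    split_ifs <;> omega
  induction k with
  | zero =>
    refine ⟨[⟨0, hk⟩], rfl, fun q hq => ?_, hfix⟩
    simp [actWord, Pstep_val, hq]
  | succ k ih =>
    obtain ⟨u, hu, h₀, h₁⟩ := ih (by omega) fun q hq => by
      apply Fin.ext
      simp only [Pstep_val]
      split_ifs <;> omega
    refine ⟨⟨k + 1, hk⟩ :: u, by simp [hu], fun q hq => ?_, fun q hq => ?_⟩
    · exact h₀ _ (by simp [Pstep_val, hq])
    · rw [actWord_cons, hfix q hq, h₁ q (by omega)]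

theorem exists_word_collapse {n : ℕ} (k : ℕ) (hk : k ≤ n - 1) :
    ∃ w : List (Fin (n - 1)), w.length = (k + 1) * k / 2 ∧
      (∀ q : Fin n, (q : ℕ) ≤ k → ((actWord (Pstep n) q w : Fin n) : ℕ) = 0) ∧
      ∀ q : Fin n, k < (q : ℕ) → actWord (Pstep n) q w = q := by
  induction k with
  | zero => exact ⟨[], rfl, fun q hq => Nat.le_zero.1 hq, fun _ _ => rfl⟩
  | succ k ih =>
    obtain ⟨w, hw, h₀, h₁⟩ := ih (by omega)
    obtain ⟨u, hu, g₀, g₁⟩ := exists_word_succ_to_zero k hk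
    refine ⟨w ++ u, ?_, fun q hq => ?_, fun q hq => ?_⟩
    · rw [List.length_append, hw, hu, ← Nat.add_mul_div_left _ _ two_pos]
      ring_nf
    · rw [actWord_append]
      rcases hq.lt_or_eq with hq | hq
      · have := h₀ q (by omega)
        rwa [actWord_Pstep_zero u _ this]
      · rw [h₁ q (by omega), g₀ q hq]
    · rw [actWord_append, h₁ q (by omega), g₁ q hq]

theorem exists_isSyncWord_length {n : ℕ} (hn : 0 < n) :
    ∃ w : List (Fin (n - 1)), IsSyncWord (Pstep n) w ∧ w.length = (n ^ 2 - n) / 2 := by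
  obtain ⟨w, hw, h, -⟩ := exists_word_collapse (n := n) (n - 1) le_rfl
  refine ⟨w, ⟨⟨0, hn⟩, fun q => Fin.ext (h q (by omega))⟩, ?_⟩
  rw [hw, Nat.sub_add_cancel hn, Nat.mul_sub_one, sq]

/-- For every `n ≥ 2`, the DFA `P_n` is synchronizing, and its switch count is
equal to its minimal synchronizing word length, which is `(n² - n)/2`. -/
theorem P_sync_sw_ssl (n : ℕ) (hn : 2 ≤ n) :
    (∃ w : List (Fin (n - 1)), IsSyncWord (Pstep n) w) ∧
      swOf (Pstep n) = (n ^ 2 - n) / 2 ∧ sslOf (Pstep n) = (n ^ 2 - n) / 2 := by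
  obtain ⟨w, hw, hlen⟩ := exists_isSyncWord_length (n := n) (by omega)
  have hlow : ∀ v : List (Fin (n - 1)), IsSyncWord (Pstep n) v → (n ^ 2 - n) / 2 ≤ swc v :=
    fun v hv => le_swc_of_isSyncWord (by omega) hv
  refine ⟨⟨w, hw⟩, le_antisymm ?_ ?_, le_antisymm ?_ ?_⟩
  · exact le_trans (Nat.sInf_le ⟨w, hw, rfl⟩) ((swc_le_length w).trans hlen.le)
  · refine le_csInf ⟨_, w, hw, rfl⟩ ?_
    rintro _ ⟨v, hv, rfl⟩
    exact hlow v hv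
  · exact Nat.sInf_le ⟨w, hw, hlen⟩
  · refine le_csInf ⟨_, w, hw, rfl⟩ ?_
    rintro _ ⟨v, hv, rfl⟩
    exact (hlow v hv).trans (swc_le_length v)
end

section
/- For every n ≥ 3, the DFA 𝒜_n is synchronizing and has switch count sw(𝒜_n) = ⌈(2/3)·n·(n−2) − 1⌉. -/
/-- The state to which both symbols map the state `n` in `𝒜_n`. -/
def Atarget (n : ℕ) : ℕ :=
  if n % 3 = 0 then n / 3 else if n % 3 = 1 then (n + 2) / 3 else (n + 4) / 3

/-- Transitions of `𝒜_n` on state numbers `1,…,n`, symbols `false` (= `a`) and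
`true` (= `b`): `1a = 1`, `1b = 2`; `(2k)a = 2k+1`, `(2k)b = 2k-1`;
`(2k+1)a = 2k`, `(2k+1)b = 2k+2`; and `na = nb = Atarget n`. -/
def Af (n x : ℕ) (s : Bool) : ℕ :=
  if x = n then Atarget n
  else if s then (if x % 2 = 0 then x - 1 else x + 1)
  else (if x = 1 then 1 else if x % 2 = 0 then x + 1 else x - 1)

/-- The binary automaton `𝒜_n`, with states `{1,…,n}` encoded as `Fin n`
(state `x` is `⟨x-1, _⟩`). -/
def Astep (n : ℕ) : Fin n → Bool → Fin n := fun q s =>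
  ⟨Af n ((q : ℕ) + 1) s - 1, by
    have hq := q.isLt
    unfold Af Atarget; split_ifs <;> omega⟩

/-- Rounds between the gap sizes `g` and `g + 1` of a largest gap. -/
def stageCost (M K g : ℕ) : ℕ := M + min (K - 1 - g) g

/-- Rounds needed after a gap of size `g + 1` has been created. -/
def remainingCost (M K g : ℕ) : ℕ := ∑ i ∈ Finset.Ico g (K - 1), stageCost M K i

theorem remainingCost_eq {M K g : ℕ} (h : g < K - 1) :
    remainingCost M K g = M + min (K - 1 - g) g + remainingCost M K (g + 1) := by
  unfold remainingCost
  rw [Finset.sum_eq_sum_Ico_succ_bot h]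
  rfl

/-- Rotation of the line `0, …, K + M - 2`, the position `0` being glued to `K - 1`. -/
def rotPos (K i : ℕ) : ℕ := if i = 0 then K - 1 else i - 1

/-- The jump of the position `0`, all the other positions being fixed. -/
def jumpPos (K i : ℕ) : ℕ := if i = 0 then K - 1 else i

/-- The positions in `A`, read modulo `K`, have a gap from `a` to `a + g`. -/
structure IsGap (K : ℕ) (A : Set ℕ) (a g : ℕ) : Prop where
  lt : a < K
  pos : 1 ≤ g
  le : g ≤ K
  lower : a ∈ A ∨ a + K ∈ A
  upper : a + g ∈ A ∨ a + g + K ∈ A ∨ ∃ u ∈ A, u + K = a + g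
  hole : ∀ z ∈ A, (z ≤ a ∨ a + g ≤ z) ∧ a + g ≤ z + K ∧ (z ≤ a + K ∨ a + g + K ≤ z)

/-- A lower bound for the number of rounds that a gap of size `g` with end points `l` and `u`
needs to fill the whole circle of length `K`. -/
def gapPotential (M K l u g : ℕ) : ℕ :=
  if g = K then 0
  else 1 + remainingCost M K g +
    if g = 1 then min l (min (K + M - 2 - u) (M - 1))
    else min (min l (K + M - 2 - u)) (min (u + M) (K + M - 2 - l + M))

/-- Every gap of `A` has end points in `A` with potential at least `D`. -/
def HasPotential (M K D : ℕ) (A : Set ℕ) : Prop :=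
  ∀ a g, IsGap K A a g → ∃ l ∈ A, ∃ u ∈ A, (l = a ∨ l = a + K) ∧
    (u = l + g ∨ u + K = l + g) ∧ D ≤ gapPotential M K l u g

theorem HasPotential.eq_zero_of_singleton {M K D x : ℕ} (hMK : 1 ≤ M ∧ 2 * M ≤ K)
    (hx : x ≤ K + M - 2) (h : HasPotential M K D {x}) : D = 0 := by
  have key : ∃ a, a < K ∧ (x = a ∨ x = a + K) := by
    by_cases hxK : x < K
    · exact ⟨x, hxK, Or.inl rfl⟩
    · exact ⟨x - K, by omega, by omega⟩
  obtain ⟨a, ha, hxa⟩ := key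
  obtain ⟨l, -, u, -, -, -, hD⟩ := h a K
    { lt := ha
      pos := by omega
      le := le_rfl
      lower := by simp only [Set.mem_singleton_iff]; omega
      upper := by
        rcases hxa with hxa | hxa
        · exact Or.inr (Or.inr ⟨x, rfl, by omega⟩)
        · exact Or.inl hxa.symm
      hole := by rintro z rfl; omega }
  simpa [gapPotential] using hD

theorem HasPotential.image_reflect {M K D : ℕ} {A : Set ℕ} (hMK : 1 ≤ M ∧ 2 * M ≤ K)
    (hA : ∀ z ∈ A, z ≤ K + M - 2) (h : HasPotential M K D A) :
    HasPotential M K D ((fun i => K + M - 2 - i) '' A) := by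
  intro a g hg
  have hlt := hg.lt
  have hpos := hg.pos
  have hle := hg.le
  have key : ∃ b, b < K ∧ (b + a + g = K + M - 2 ∨ b + a + g = K + M - 2 + K ∨
      b + a + g + K = K + M - 2) := by
    by_cases h1 : K + M - 2 < a + g
    · exact ⟨K + M - 2 + K - a - g, by omega, by omega⟩
    · by_cases h2 : K + M - 2 - a - g < K
      · exact ⟨K + M - 2 - a - g, by omega, by omega⟩
      · exact ⟨K + M - 2 - a - g - K, by omega, by omega⟩
  obtain ⟨b, hb, hba⟩ := key
  have hgap : IsGap K A b g :=
    { lt := hb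
      pos := hpos
      le := hle
      lower := by
        have mem : ∀ z ∈ A, z = b ∨ z = b + K → b ∈ A ∨ b + K ∈ A := by
          rintro z hz (rfl | rfl) <;> simp [hz]
        rcases hg.upper with ⟨z, hz, hz'⟩ | ⟨z, hz, hz'⟩ | ⟨_, ⟨z, hz, rfl⟩, hz'⟩ <;>
        · have := hA z hz
          exact mem z hz (by dsimp only at hz'; omega)
      upper := by
        have mem : ∀ z ∈ A, z = b + g ∨ z = b + g + K ∨ z + K = b + g →
            b + g ∈ A ∨ b + g + K ∈ A ∨ ∃ u ∈ A, u + K = b + g := by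
          rintro z hz (rfl | rfl | hz')
          · exact Or.inl hz
          · exact Or.inr (Or.inl hz)
          · exact Or.inr (Or.inr ⟨z, hz, hz'⟩)
        rcases hg.lower with ⟨z, hz, hz'⟩ | ⟨z, hz, hz'⟩ <;>
        · have := hA z hz
          exact mem z hz (by dsimp only at hz'; omega)
      hole := by
        intro z hz
        have h1 := hA z hz
        have h2 := hg.hole _ ⟨z, hz, rfl⟩
        dsimp only at h2
        omega }
  obtain ⟨l, hl, u, hu, hlb, hul, hD⟩ := h b g hgap
  have h1 := hA l hl
  have h2 := hA u hu
  refine ⟨_, ⟨u, hu, rfl⟩, _, ⟨l, hl, rfl⟩, ?_, ?_, ?_⟩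
  · dsimp only; omega
  · dsimp only; omega
  · refine hD.trans ?_
    dsimp only [gapPotential]
    split_ifs <;> omega

/-- Gaps of a rotated set are rotated gaps. -/
theorem IsGap.of_image_rotPos {M K a g : ℕ} {A : Set ℕ} (hMK : 1 ≤ M ∧ 2 * M ≤ K)
    (hA : ∀ z ∈ A, z ≤ K + M - 2) (hg : IsGap K (rotPos K '' A) a g) :
    ∃ b, IsGap K A b g ∧ (b = a + 1 ∨ b + K = a + 1) := by
  have hlt := hg.lt
  have hpos := hg.pos
  have hle := hg.le
  have key : ∃ b, b < K ∧ (b = a + 1 ∨ b + K = a + 1) := by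
    by_cases h1 : a + 1 < K
    · exact ⟨a + 1, h1, Or.inl rfl⟩
    · exact ⟨0, by omega, by omega⟩
  obtain ⟨b, hb, hba⟩ := key
  refine ⟨b, ?_, hba⟩
  exact
    { lt := hb
      pos := hpos
      le := hle
      lower := by
        have mem : ∀ z ∈ A, z = b ∨ z = b + K → b ∈ A ∨ b + K ∈ A := by
          rintro z hz (rfl | rfl) <;> simp [hz]
        rcases hg.lower with ⟨z, hz, hz'⟩ | ⟨z, hz, hz'⟩ <;>
        · have := hA z hz
          exact mem z hz (by unfold rotPos at hz'; split_ifs at hz' <;> omega)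
      upper := by
        have mem : ∀ z ∈ A, z = b + g ∨ z = b + g + K ∨ z + K = b + g →
            b + g ∈ A ∨ b + g + K ∈ A ∨ ∃ u ∈ A, u + K = b + g := by
          rintro z hz (rfl | rfl | hz')
          · exact Or.inl hz
          · exact Or.inr (Or.inl hz)
          · exact Or.inr (Or.inr ⟨z, hz, hz'⟩)
        rcases hg.upper with ⟨z, hz, hz'⟩ | ⟨z, hz, hz'⟩ | ⟨_, ⟨z, hz, rfl⟩, hz'⟩ <;>
        · have := hA z hz
          exact mem z hz (by unfold rotPos at hz'; split_ifs at hz' <;> omega)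
      hole := by
        intro z hz
        have h1 := hA z hz
        have h2 := hg.hole _ ⟨z, hz, rfl⟩
        unfold rotPos at h2
        split_ifs at h2 <;> omega }

theorem HasPotential.image_rotPos {M K D : ℕ} {A : Set ℕ} (hMK : 1 ≤ M ∧ 2 * M ≤ K)
    (hA : ∀ z ∈ A, z ≤ K + M - 2) (h : HasPotential M K (D + 1) A) :
    HasPotential M K D (rotPos K '' A) := by
  intro a g hg
  obtain ⟨b, hgap, hba⟩ := hg.of_image_rotPos hMK hA
  have hlt := hg.lt
  have hpos := hg.pos
  have hle := hg.le
  obtain ⟨l, hl, u, hu, hlb, hul, hD⟩ := h b g hgap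
  have h1 := hA l hl
  have h2 := hA u hu
  have h3 : ∀ z ∈ A, _ := fun z hz => hg.hole _ ⟨z, hz, rfl⟩
  by_cases hgK : g = K
  · simp [gapPotential, hgK] at hD
  refine ⟨_, ⟨l, hl, rfl⟩, _, ⟨u, hu, rfl⟩, ?_, ?_, ?_⟩
  · unfold rotPos; split_ifs <;> omega
  · unfold rotPos; split_ifs <;> omega
  · unfold gapPotential rotPos at *
    split_ifs at * <;> omega

theorem remainingCost_anti (M K : ℕ) {g h : ℕ} (hgh : g ≤ h) :
    remainingCost M K h ≤ remainingCost M K g :=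
  Finset.sum_le_sum_of_subset (Finset.Ico_subset_Ico_left hgh)

theorem le_gapPotential_iff {M K D l u g : ℕ} (h : g ≠ K) :
    D ≤ gapPotential M K l u g ↔ D ≤ 1 + remainingCost M K g + l ∧
      D ≤ 1 + remainingCost M K g + (K + M - 2 - u) ∧
      (g = 1 → D ≤ 1 + remainingCost M K g + (M - 1)) ∧
      (g ≠ 1 → D ≤ 1 + remainingCost M K g + (u + M) ∧
        D ≤ 1 + remainingCost M K g + (K + M - 2 - l + M)) := by
  unfold gapPotential
  rw [if_neg h]
  split_ifs <;> omega

theorem gapPotential_le_pred (M K l u g : ℕ) :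
    gapPotential M K l u g ≤ gapPotential M K (l - 1) (u - 1) g + 1 := by
  unfold gapPotential
  split_ifs <;> omega

theorem gapPotential_one_le (M K l u : ℕ) :
    gapPotential M K l u 1 ≤ 1 + remainingCost M K 1 + (M - 1) := by
  unfold gapPotential
  split_ifs <;> omega

theorem gapPotential_seam {M K D : ℕ} (hM : 1 ≤ M) (hK : 2 * M ≤ K)
    (hD : D + 1 ≤ 1 + remainingCost M K 1 + (M - 1)) :
    D ≤ gapPotential M K (K - 1) K 1 ∧ D ≤ gapPotential M K (K - 1 - 1) (K - 1) 1 := by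
  rw [le_gapPotential_iff (by omega), le_gapPotential_iff (by omega)]
  generalize remainingCost M K 1 = c at *
  refine ⟨⟨?_, ?_, ?_, ?_⟩, ?_, ?_, ?_, ?_⟩ <;> omega

/-- The strengthening of `HasPotential` that survives a jump followed by an optional rotation. -/
theorem HasPotential.image_jumpPos_aux {M K D : ℕ} {A : Set ℕ}
    (hMK : 1 ≤ M ∧ 2 * M ≤ K ∧ K ≤ 2 * M + 2)
    (hA : ∀ z ∈ A, z ≤ K + M - 2) (h : HasPotential M K (D + 1) A) (a g : ℕ)
    (hg : IsGap K (jumpPos K '' A) a g) :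
    ∃ l ∈ jumpPos K '' A, ∃ u ∈ jumpPos K '' A, (l = a ∨ l = a + K) ∧
      (u = l + g ∨ u + K = l + g) ∧ D ≤ gapPotential M K l u g ∧
      D ≤ gapPotential M K (l - 1) (u - 1) g := by
  have hlt := hg.lt
  have hpos := hg.pos
  have hle := hg.le
  by_cases h0 : 0 ∈ A
  swap
  · have himg : jumpPos K '' A = A := by
      have : Set.EqOn (jumpPos K) id A := by
        intro z hz
        have : z ≠ 0 := by rintro rfl; exact h0 hz
        simp [jumpPos, this]
      rw [this.image_eq, Set.image_id]
    rw [himg] at hg ⊢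
    obtain ⟨l, hl, u, hu, hlb, hul, hD⟩ := h a g hg
    have hl0 : l ≠ 0 := by rintro rfl; exact h0 hl
    have hu0 : u ≠ 0 := by rintro rfl; exact h0 hu
    have h1 := hA l hl
    have h2 := hA u hu
    exact ⟨l, hl, u, hu, hlb, hul, by omega,
      by have := gapPotential_le_pred M K l u g; omega⟩
  have hmem : ∀ z, z ∈ jumpPos K '' A ↔ (z ∈ A ∧ z ≠ 0) ∨ z = K - 1 := by
    intro z
    constructor
    · rintro ⟨y, hy, rfl⟩
      unfold jumpPos
      split_ifs with h
      · exact Or.inr rfl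
      · exact Or.inl ⟨hy, h⟩
    · rintro (⟨hz, hz0⟩ | rfl)
      · exact ⟨z, hz, by simp [jumpPos, hz0]⟩
      · exact ⟨0, h0, by simp [jumpPos]⟩
  generalize jumpPos K '' A = B at hg hmem ⊢
  have hlast : K - 1 ∈ B := (hmem _).2 (Or.inr rfl)
  have hB : ∀ z ∈ A, z ≠ 0 → z ∈ B := fun z hz hz0 => (hmem z).2 (Or.inl ⟨hz, hz0⟩)
  have hBA : ∀ z ∈ B, z ≠ K - 1 → z ∈ A ∧ z ≠ 0 := fun z hz hz' =>
    ((hmem z).1 hz).resolve_right hz'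
  have hrec : ∀ g, g < K - 1 → _ := fun g hg => remainingCost_eq (M := M) (K := K) (g := g) hg
  by_cases haK : a = K - 1
  · subst haK
    by_cases hK : K ∈ A
    · have hKm := hA K hK
      have hg1 : g = 1 := by have := hg.hole K (hB K hK (by omega)); omega
      subst hg1
      refine ⟨K - 1, hlast, K, hB K hK (by omega), Or.inl rfl, Or.inl (by omega), ?_⟩
      by_cases hP : K - 1 ∈ A
      · obtain ⟨l, hl, u, hu, hlb, hul, hD⟩ := h (K - 1) 1
          { lt := hlt
            pos := hpos
            le := hle
            lower := Or.inl hP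
            upper := Or.inl (by rwa [Nat.sub_add_cancel (by omega)])
            hole := by intro z hz; have := hA z hz; omega }
        exact gapPotential_seam hMK.1 hMK.2.1 (hD.trans (gapPotential_one_le ..))
      · obtain ⟨b, hbK, hbA, hbmax⟩ : ∃ b, b < K ∧ (b ∈ A ∨ b + K ∈ A) ∧
            ∀ c, b < c → c < K → ¬ (c ∈ A ∨ c + K ∈ A) := by
          classical
          have hspec := Nat.findGreatest_spec (P := fun b => b ∈ A ∨ b + K ∈ A) (n := K - 1)
            (Nat.zero_le _) (Or.inl h0)
          have hble := Nat.findGreatest_le (P := fun b => b ∈ A ∨ b + K ∈ A) (K - 1)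
          exact ⟨_, by omega, hspec, fun c hc hcK =>
            Nat.findGreatest_is_greatest hc (by omega)⟩
        have hb1 : b ≠ K - 1 := by
          rintro rfl
          rcases hbA with hbA | hbA
          · exact hP hbA
          · have := hA _ hbA; omega
        obtain ⟨l, hl, u, hu, hlb, hul, hD⟩ := h b (K - b)
          { lt := hbK
            pos := by omega
            le := by omega
            lower := hbA
            upper := Or.inl (by rwa [Nat.add_sub_cancel' hbK.le])
            hole := by
              intro z hz
              have h1 := hA z hz
              have h2 : z < K → z ≤ b := by
                intro hzK
                by_contra hzb
                exact hbmax z (by omega) hzK (Or.inl hz)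
              have h3 : K ≤ z → z ≤ b + K := by
                intro hzK
                by_contra hzb
                exact hbmax (z - K) (by omega) (by omega)
                  (Or.inr (by rwa [Nat.sub_add_cancel hzK]))
              omega }
        have h1 := hA l hl
        by_cases hb0 : b = 0
        · simp [gapPotential, hb0] at hD
        have e1 := hrec 1 (by omega)
        have e2 := remainingCost_anti M K (show 1 + 1 ≤ K - b by omega)
        rw [le_gapPotential_iff (by omega)] at hD
        have h2 := hA u hu
        have hu' : u = 0 ∨ u = K := by omega
        refine gapPotential_seam hMK.1 hMK.2.1 ?_
        clear hrec hlb hul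
        rcases hu' with rfl | rfl <;> omega
    · by_cases hgK : g = K
      · subst hgK
        have hall : ∀ z ∈ A, z = 0 ∨ z = g - 1 := by
          intro z hz
          by_contra hne
          have h1 := hA z hz
          have h2 := hg.hole z (hB z hz (by omega))
          omega
        by_cases hP : g - 1 ∈ A
        · obtain ⟨l, hl, u, hu, hlb, hul, hD⟩ := h 0 (g - 1)
            { lt := by omega
              pos := by omega
              le := by omega
              lower := Or.inl h0
              upper := Or.inl (by rwa [Nat.zero_add])
              hole := by intro z hz; have := hall z hz; omega }
          have hl0 : l = 0 := by have := hall l hl; omega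
          refine ⟨g - 1, hlast, g - 1, hlast, by omega, by omega, ?_⟩
          have : remainingCost M g (g - 1) = 0 := by simp [remainingCost]
          rw [le_gapPotential_iff (by omega), hl0, this] at hD
          suffices D = 0 by omega
          omega
        · obtain ⟨l, hl, u, hu, hlb, hul, hD⟩ := h 0 g
            { lt := by omega
              pos := by omega
              le := by omega
              lower := Or.inl h0
              upper := Or.inr (Or.inr ⟨0, h0, rfl⟩)
              hole := by
                intro z hz
                have := hall z hz
                have : z ≠ g - 1 := by rintro rfl; exact hP hz
                omega }
          simp [gapPotential] at hD
      · have hzero : 0 ∉ B := fun h => (hBA 0 h (by omega)).2 rfl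
        have hKB : K ∉ B := fun h => hK (hBA K h (by omega)).1
        have hupper : ∃ u ∈ A, u ≠ 0 ∧ (u = g - 1 ∨ u = K - 1 + g) ∧ g ≠ 1 := by
          rcases hg.upper with hu | hu | ⟨u, hu, hu'⟩
          · have hg1 : g ≠ 1 := by
              rintro rfl
              exact hKB (by rwa [Nat.sub_add_cancel (by omega)] at hu)
            exact ⟨_, (hBA _ hu (by omega)).1, by omega, Or.inr rfl, hg1⟩
          · have := hA _ (hBA _ hu (by omega)).1
            omega
          · have hg1 : g ≠ 1 := by
              rintro rfl
              exact hzero (by rwa [show u = 0 by omega] at hu)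
            exact ⟨u, (hBA u hu (by omega)).1, by omega, by omega, hg1⟩
        obtain ⟨u₀, hu₀, hu₀0, hu₀', hg1⟩ := hupper
        obtain ⟨l, hl, u, hu, hlb, hul, hD⟩ := h 0 (g - 1)
          { lt := by omega
            pos := by omega
            le := by omega
            lower := Or.inl h0
            upper := by
              rcases hu₀' with rfl | rfl
              · exact Or.inl (by rwa [Nat.zero_add])
              · exact Or.inr (Or.inl (by rwa [show 0 + (g - 1) + K = K - 1 + g by omega]))
            hole := by
              intro z hz
              by_cases hz0 : z = 0
              · omega
              · have := hg.hole z (hB z hz hz0)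
                omega }
        have hl0 : l = 0 := by
          rcases hlb with rfl | rfl
          · rfl
          · exact absurd (by simpa using hl) hK
        subst hl0
        have hug : u = g - 1 := by omega
        subst hug
        refine ⟨K - 1, hlast, g - 1, hB _ hu (by omega), by omega, by omega, ?_⟩
        have e1 := hrec (g - 1) (by omega)
        rw [Nat.sub_add_cancel hpos] at e1
        clear hrec hlb hul
        rw [le_gapPotential_iff (by omega)] at hD
        rw [le_gapPotential_iff hgK, le_gapPotential_iff hgK]
        refine ⟨⟨?_, ?_, ?_, ?_⟩, ?_, ?_, ?_, ?_⟩ <;> omega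
  by_cases hP : a + g = K - 1 ∧ K - 1 ∉ A
  · obtain ⟨hag, hP⟩ := hP
    obtain ⟨l, hl, u, hu, hlb, hul, hD⟩ := h a (g + 1)
      { lt := hlt
        pos := by omega
        le := by omega
        lower := hg.lower.imp (fun h => (hBA _ h haK).1) (fun h => (hBA _ h (by omega)).1)
        upper := Or.inr (Or.inr ⟨0, h0, by omega⟩)
        hole := by
          intro z hz
          by_cases hz0 : z = 0
          · omega
          · have h1 := hg.hole z (hB z hz hz0)
            have h2 := hA z hz
            have h3 : z ≠ K - 1 := by rintro rfl; exact hP hz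
            omega }
    by_cases hgK : g + 1 = K
    · simp [gapPotential, hgK] at hD
    have h1 := hA l hl
    have h2 := hA u hu
    refine ⟨l, hB l hl (by omega), K - 1, hlast, hlb, by omega, ?_⟩
    have e1 := hrec g (by omega)
    rw [le_gapPotential_iff (by omega)] at hD
    rw [le_gapPotential_iff (by omega), le_gapPotential_iff (by omega)]
    clear hrec
    refine ⟨⟨?_, ?_, ?_, ?_⟩, ?_, ?_, ?_, ?_⟩ <;> omega
  · have hag : a + g ≤ K - 1 := by have := hg.hole _ hlast; omega
    obtain ⟨l, hl, u, hu, hlb, hul, hD⟩ := h a g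
      { lt := hlt
        pos := hpos
        le := hle
        lower := hg.lower.imp (fun h => (hBA _ h haK).1) (fun h => (hBA _ h (by omega)).1)
        upper := by
          by_cases hag' : a + g = K - 1
          · rw [hag']
            exact Or.inl (by by_contra h; exact hP ⟨hag', h⟩)
          · rcases hg.upper with hu | hu | ⟨u, hu, hu'⟩
            · exact Or.inl (hBA _ hu hag').1
            · exact Or.inr (Or.inl (hBA _ hu (by omega)).1)
            · omega
        hole := by
          intro z hz
          by_cases hz0 : z = 0
          · omega
          · exact hg.hole z (hB z hz hz0) }
    have h2 := hA u hu
    have huB := hB u hu (by omega)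
    by_cases hl0 : l = 0
    · have ha0 : a = 0 := by omega
      subst hl0 ha0
      have hKB : K ∈ B := by
        rcases hg.lower with h | h
        · exact absurd rfl (hBA 0 h (by omega)).2
        · simpa using h
      have h1 := hA K (hBA K hKB (by omega)).1
      refine ⟨K, hKB, u, huB, by omega, by omega, ?_⟩
      rw [le_gapPotential_iff (by omega)] at hD
      rw [le_gapPotential_iff (by omega), le_gapPotential_iff (by omega)]
      clear hrec
      refine ⟨⟨?_, ?_, ?_, ?_⟩, ?_, ?_, ?_, ?_⟩ <;> omega
    · have h1 := hA l hl
      exact ⟨l, hB l hl hl0, u, huB, hlb, hul, by omega,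
        by have := gapPotential_le_pred M K l u g; omega⟩

/-- The numerical data of `𝒜_n`: `K` is the length of the circle and `M - 1` the length of the
tail of the line of positions. -/
structure IsShape (n M K : ℕ) : Prop where
  size : n = K + M
  pos : 1 ≤ M
  lower : 2 * M ≤ K
  upper : K ≤ 2 * M + 2

/-- The symbol labelling the transitions between `n - 1` and `n`. -/
def pSym (n : ℕ) : Bool := decide (n % 2 = 0)

/-- The state at position `i` of the line that is met before reading `pSym n`. -/
def stP (n i : ℕ) : ℕ := if 2 * i + 2 ≤ n then n - 1 - 2 * i else 2 * i + 2 - n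

/-- The state at position `i` of the line that is met before reading `!pSym n`. -/
def stQ (n i : ℕ) : ℕ := if 2 * i + 1 ≤ n then n - 2 * i else 2 * i + 1 - n

theorem stP_injective {n i j : ℕ} (h : stP n i = stP n j) : i = j := by
  unfold stP at h
  split_ifs at h <;> omega

theorem stP_pos {n i : ℕ} (hi : i + 2 ≤ n) : 1 ≤ stP n i ∧ stP n i ≤ n := by
  unfold stP
  split_ifs <;> omega

theorem exists_stP_eq {n x : ℕ} (hx : 1 ≤ x) (hxn : x < n) : ∃ i, i + 2 ≤ n ∧ stP n i = x := by
  by_cases h : (n - 1 - x) % 2 = 0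
  · exact ⟨(n - 1 - x) / 2, by omega, by unfold stP; split_ifs <;> omega⟩
  · exact ⟨(n + x - 2) / 2, by omega, by unfold stP; split_ifs <;> omega⟩

theorem rotPos_le {M K i : ℕ} (hM : 1 ≤ M) (hi : i ≤ K + M - 2) : rotPos K i ≤ K + M - 2 := by
  unfold rotPos
  split_ifs <;> omega

theorem jumpPos_le {M K i : ℕ} (hM : 1 ≤ M) (hi : i ≤ K + M - 2) : jumpPos K i ≤ K + M - 2 := by
  unfold jumpPos
  split_ifs <;> omega

theorem jumpPos_jumpPos (K i : ℕ) : jumpPos K (jumpPos K i) = jumpPos K i := by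
  unfold jumpPos
  split_ifs <;> omega

namespace IsShape

variable {n M K : ℕ}

theorem Atarget_eq (h : IsShape n M K) : Atarget n = K - M := by
  obtain ⟨h1, h2, h3, h4⟩ := h
  unfold Atarget
  split_ifs <;> omega

theorem Af_stP (h : IsShape n M K) {i : ℕ} (hi : i ≤ K + M - 2) :
    Af n (stP n i) (pSym n) = stQ n i := by
  obtain ⟨h1, h2, h3, h4⟩ := h
  unfold Af pSym stP stQ
  simp only [decide_eq_true_eq]
  split_ifs <;> omega

theorem Af_stP_not (h : IsShape n M K) {i : ℕ} (hi : i ≤ K + M - 2) :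
    Af n (stP n i) (!pSym n) = stP n (K + M - 2 - i) := by
  obtain ⟨h1, h2, h3, h4⟩ := h
  unfold Af pSym stP
  simp only [Bool.not_eq_true', decide_eq_false_iff_not]
  split_ifs <;> omega

theorem Af_stQ (h : IsShape n M K) {i : ℕ} (hi : i ≤ K + M - 2) :
    Af n (stQ n i) (pSym n) = stP n (jumpPos K i) := by
  rcases Nat.eq_zero_or_pos i with rfl | hi0
  · have := h.Atarget_eq
    obtain ⟨h1, h2, h3, h4⟩ := h
    have : stQ n 0 = n := by unfold stQ; split_ifs <;> omega
    rw [this]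
    unfold Af jumpPos stP
    split_ifs <;> omega
  · obtain ⟨h1, h2, h3, h4⟩ := h
    have : jumpPos K i = i := by simp [jumpPos, hi0.ne']
    rw [this]
    unfold Af pSym stP stQ
    simp only [decide_eq_true_eq]
    split_ifs <;> omega

theorem Af_stQ_not (h : IsShape n M K) {i : ℕ} (hi : i ≤ K + M - 2) :
    Af n (stQ n i) (!pSym n) = stP n (rotPos K i) := by
  rcases Nat.eq_zero_or_pos i with rfl | hi0
  · have := h.Atarget_eq
    obtain ⟨h1, h2, h3, h4⟩ := h
    have : stQ n 0 = n := by unfold stQ; split_ifs <;> omega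
    rw [this]
    unfold Af rotPos stP
    split_ifs <;> omega
  · obtain ⟨h1, h2, h3, h4⟩ := h
    have : rotPos K i = i - 1 := by simp [rotPos, hi0.ne']
    rw [this]
    unfold Af pSym stP stQ
    simp only [Bool.not_eq_true', decide_eq_false_iff_not]
    split_ifs <;> omega

theorem actWord_not_pow (h : IsShape n M K) (j : ℕ) :
    ∃ f : ℕ → ℕ, (f = id ∨ f = fun i => K + M - 2 - i) ∧ ∀ i ≤ K + M - 2,
      actWord (Af n) (stP n i) (List.replicate j (!pSym n)) = stP n (f i) := by
  induction j with
  | zero => exact ⟨id, Or.inl rfl, fun i _ => rfl⟩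
  | succ j ih =>
    obtain ⟨f, rfl | rfl, hf⟩ := ih
    · refine ⟨_, Or.inr rfl, fun i hi => ?_⟩
      rw [List.replicate_succ', actWord, List.foldl_append]
      simp only [actWord] at hf
      simp only [hf i hi, List.foldl_cons, List.foldl_nil, id_eq, h.Af_stP_not hi]
    · refine ⟨_, Or.inl rfl, fun i hi => ?_⟩
      rw [List.replicate_succ', actWord, List.foldl_append]
      simp only [actWord] at hf
      simp only [hf i hi, List.foldl_cons, List.foldl_nil, id_eq, h.Af_stP_not (Nat.sub_le _ i),
        Nat.sub_sub_self hi]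

theorem actWord_pow (h : IsShape n M K) (k : ℕ) :
    (∀ i ≤ K + M - 2,
      actWord (Af n) (stP n i) (List.replicate (k + 1) (pSym n)) = stQ n i) ∨
    (∀ i ≤ K + M - 2,
      actWord (Af n) (stP n i) (List.replicate (k + 1) (pSym n)) = stP n (jumpPos K i)) ∨
    ∀ i ≤ K + M - 2,
      actWord (Af n) (stP n i) (List.replicate (k + 1) (pSym n)) = stQ n (jumpPos K i) := by
  induction k with
  | zero => exact Or.inl fun i hi => h.Af_stP hi
  | succ k ih =>
    have hs : ∀ i, actWord (Af n) (stP n i) (List.replicate (k + 1 + 1) (pSym n)) =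
        Af n (actWord (Af n) (stP n i) (List.replicate (k + 1) (pSym n))) (pSym n) := by
      intro i
      rw [List.replicate_succ', actWord, List.foldl_append]
      rfl
    rcases ih with ih | ih | ih
    · exact Or.inr (Or.inl fun i hi => by rw [hs, ih i hi, h.Af_stQ hi])
    · exact Or.inr (Or.inr fun i hi => by rw [hs, ih i hi, h.Af_stP (jumpPos_le h.pos hi)])
    · exact Or.inr (Or.inl fun i hi => by
        rw [hs, ih i hi, h.Af_stQ (jumpPos_le h.pos hi), jumpPos_jumpPos])

/-- A block of `pSym n` followed by a block of the other symbol acts on the positions by one of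
the maps `rotPos`, `jumpPos`, and `rotPos ∘ jumpPos`, possibly followed by a reflection. -/
theorem actWord_round (h : IsShape n M K) (k j : ℕ) :
    ∃ f r : ℕ → ℕ, (f = rotPos K ∨ f = jumpPos K ∨ f = rotPos K ∘ jumpPos K) ∧
      (r = id ∨ r = fun i => K + M - 2 - i) ∧ ∀ i ≤ K + M - 2,
      actWord (Af n) (stP n i)
        (List.replicate (k + 1) (pSym n) ++ List.replicate (j + 1) (!pSym n)) =
        stP n (r (f i)) := by
  have happ : ∀ i, actWord (Af n) (stP n i)
      (List.replicate (k + 1) (pSym n) ++ List.replicate (j + 1) (!pSym n)) =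
      actWord (Af n) (actWord (Af n) (stP n i) (List.replicate (k + 1) (pSym n)))
        (List.replicate (j + 1) (!pSym n)) := fun i => List.foldl_append
  have hQ : ∀ i ≤ K + M - 2, actWord (Af n) (stQ n i) (List.replicate (j + 1) (!pSym n)) =
      actWord (Af n) (stP n (rotPos K i)) (List.replicate j (!pSym n)) := by
    intro i hi
    rw [List.replicate_succ, ← h.Af_stQ_not hi]
    rfl
  rcases h.actWord_pow k with hk | hk | hk
  · obtain ⟨r, hr, hf⟩ := h.actWord_not_pow j
    exact ⟨_, r, Or.inl rfl, hr, fun i hi => by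
      rw [happ, hk i hi, hQ i hi, hf _ (rotPos_le h.pos hi)]⟩
  · obtain ⟨r, hr, hf⟩ := h.actWord_not_pow (j + 1)
    exact ⟨_, r, Or.inr (Or.inl rfl), hr, fun i hi => by
      rw [happ, hk i hi, hf _ (jumpPos_le h.pos hi)]⟩
  · obtain ⟨r, hr, hf⟩ := h.actWord_not_pow j
    exact ⟨_, r, Or.inr (Or.inr rfl), hr, fun i hi => by
      have hi' := jumpPos_le h.pos hi
      rw [happ, hk i hi, hQ _ hi', hf _ (rotPos_le h.pos hi'), Function.comp_apply]⟩

end IsShape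

theorem HasPotential.image_jumpPos {M K D : ℕ} {A : Set ℕ}
    (hMK : 1 ≤ M ∧ 2 * M ≤ K ∧ K ≤ 2 * M + 2)
    (hA : ∀ z ∈ A, z ≤ K + M - 2) (h : HasPotential M K (D + 1) A) :
    HasPotential M K D (jumpPos K '' A) := by
  intro a g hg
  obtain ⟨l, hl, u, hu, hla, hul, hD, -⟩ := h.image_jumpPos_aux hMK hA a g hg
  exact ⟨l, hl, u, hu, hla, hul, hD⟩

theorem HasPotential.image_rotPos_jumpPos {M K D : ℕ} {A : Set ℕ}
    (hMK : 1 ≤ M ∧ 2 * M ≤ K ∧ K ≤ 2 * M + 2)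
    (hA : ∀ z ∈ A, z ≤ K + M - 2) (h : HasPotential M K (D + 1) A) :
    HasPotential M K D (rotPos K '' (jumpPos K '' A)) := by
  intro a g hg
  have hJ : ∀ z ∈ jumpPos K '' A, z ≤ K + M - 2 ∧ z ≠ 0 := by
    rintro _ ⟨z, hz, rfl⟩
    refine ⟨jumpPos_le hMK.1 (hA z hz), ?_⟩
    unfold jumpPos
    split_ifs <;> omega
  obtain ⟨b, hb, hba⟩ := hg.of_image_rotPos ⟨hMK.1, hMK.2.1⟩ fun z hz => (hJ z hz).1
  obtain ⟨l, hl, u, hu, hlb, hul, -, hD⟩ := h.image_jumpPos_aux hMK hA b g hb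
  have hl0 := (hJ l hl).2
  have hu0 := (hJ u hu).2
  have hlt := hg.lt
  have hl1 : rotPos K l = l - 1 := by simp [rotPos, hl0]
  have hu1 : rotPos K u = u - 1 := by simp [rotPos, hu0]
  have hlm := (hJ l hl).1
  have hbl := hb.lt
  by_cases hlK : l - 1 = a ∨ l - 1 = a + K
  · exact ⟨l - 1, ⟨l, hl, hl1⟩, u - 1, ⟨u, hu, hu1⟩, hlK, by omega, hD⟩
  · omega

/-- The initial potential. -/
theorem HasPotential.full {M K : ℕ} (hMK : 1 ≤ M ∧ 2 * M ≤ K) :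
    HasPotential M K (M + remainingCost M K 1) {i | i ≤ K + M - 2} := by
  intro a g hg
  have hlt := hg.lt
  have hpos := hg.pos
  have hle := hg.le
  have hg1 : g = 1 := by
    by_cases haK : a = K - 1
    · have := hg.hole 0 (Nat.zero_le _)
      omega
    · have := hg.hole (a + 1) (show a + 1 ≤ K + M - 2 by omega)
      omega
  subst hg1
  by_cases haK : a = K - 1
  · refine ⟨a, show a ≤ _ by omega, 0, Nat.zero_le _, by omega, by omega, ?_⟩
    rw [le_gapPotential_iff (by omega)]
    refine ⟨?_, ?_, ?_, ?_⟩ <;> omega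
  by_cases haM : M - 1 ≤ a
  · refine ⟨a, show a ≤ _ by omega, a + 1, show a + 1 ≤ _ by omega, by omega, by omega, ?_⟩
    rw [le_gapPotential_iff (by omega)]
    refine ⟨?_, ?_, ?_, ?_⟩ <;> omega
  · refine ⟨a + K, show a + K ≤ _ by omega, a + 1, show a + 1 ≤ _ by omega, by omega, by omega,
      ?_⟩
    rw [le_gapPotential_iff (by omega)]
    refine ⟨?_, ?_, ?_, ?_⟩ <;> omega

theorem exists_replicate_append (c : Bool) (w : List Bool) :
    ∃ k v, w = List.replicate k c ++ v ∧ (v = [] ∨ v.head? = some (!c)) := by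
  induction w with
  | nil => exact ⟨0, [], rfl, Or.inl rfl⟩
  | cons x w ih =>
    by_cases hx : x = c
    · obtain ⟨k, v, rfl, hv⟩ := ih
      exact ⟨k + 1, v, by rw [hx, List.replicate_succ, List.cons_append], hv⟩
    · exact ⟨0, x :: w, rfl, Or.inr (by cases x <;> cases c <;> simp_all)⟩

theorem swc_replicate_append (c : Bool) (k : ℕ) {v : List Bool} (hv : v.head? ≠ some c) :
    swc (List.replicate (k + 1) c ++ v) = 1 + swc v := by
  induction k with
  | zero =>
    cases v with
    | nil => rfl
    | cons x v =>
      have : c ≠ x := by rintro rfl; exact hv rfl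
      simp [swc, this]
  | succ k ih =>
    rw [← ih, List.replicate_succ, List.replicate_succ, List.cons_append, List.cons_append, swc]
    simp

namespace IsShape

variable {n M K : ℕ}

theorem hasPotential_round (h : IsShape n M K) (k j : ℕ) :
    ∃ f : ℕ → ℕ, (∀ i ≤ K + M - 2, f i ≤ K + M - 2 ∧ actWord (Af n) (stP n i)
        (List.replicate (k + 1) (pSym n) ++ List.replicate (j + 1) (!pSym n)) = stP n (f i)) ∧
      ∀ D A, (∀ z ∈ A, z ≤ K + M - 2) → HasPotential M K (D + 1) A →
        HasPotential M K D (f '' A) := by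
  obtain ⟨f, r, hf, hr, hact⟩ := h.actWord_round k j
  have hMK := And.intro h.pos (And.intro h.lower h.upper)
  have hle : ∀ i ≤ K + M - 2, f i ≤ K + M - 2 := by
    intro i hi
    rcases hf with rfl | rfl | rfl
    · exact rotPos_le h.pos hi
    · exact jumpPos_le h.pos hi
    · exact rotPos_le h.pos (jumpPos_le h.pos hi)
  have hfpot : ∀ D A, (∀ z ∈ A, z ≤ K + M - 2) → HasPotential M K (D + 1) A →
      HasPotential M K D (f '' A) := by
    intro D A hA hD
    rcases hf with rfl | rfl | rfl
    · exact hD.image_rotPos ⟨h.pos, h.lower⟩ hA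
    · exact hD.image_jumpPos hMK hA
    · rw [Set.image_comp]
      exact hD.image_rotPos_jumpPos hMK hA
  refine ⟨r ∘ f, fun i hi => ⟨?_, hact i hi⟩, fun D A hA hD => ?_⟩
  · rcases hr with rfl | rfl
    · exact hle i hi
    · exact Nat.sub_le _ _
  · rw [Set.image_comp]
    rcases hr with rfl | rfl
    · rw [Set.image_id]
      exact hfpot D A hA hD
    · refine (hfpot D A hA hD).image_reflect ⟨h.pos, h.lower⟩ ?_
      rintro _ ⟨z, hz, rfl⟩
      exact hle z (hA z hz)

theorem eq_zero_of_subsingleton (h : IsShape n M K) {D s : ℕ} {A : Set ℕ} (hne : A.Nonempty)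
    (hA : ∀ z ∈ A, z ≤ K + M - 2) (hD : HasPotential M K D A) (hs : ∀ i ∈ A, stP n i = s) :
    D = 0 := by
  obtain ⟨x, hx⟩ := hne
  have hAx : A = {x} := by
    ext y
    constructor
    · intro hy
      exact stP_injective (n := n) ((hs y hy).trans (hs x hx).symm)
    · rintro rfl
      exact hx
  subst hAx
  exact hD.eq_zero_of_singleton ⟨h.pos, h.lower⟩ (hA x hx)

theorem two_mul_le_swc (h : IsShape n M K) (w : List Bool)
    (hw : w = [] ∨ w.head? = some (pSym n)) (D s : ℕ) (A : Set ℕ) (hne : A.Nonempty)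
    (hA : ∀ z ∈ A, z ≤ K + M - 2) (hD : HasPotential M K D A)
    (hs : ∀ i ∈ A, actWord (Af n) (stP n i) w = s) : 2 * D ≤ swc w + 1 := by
  induction hlen : w.length using Nat.strong_induction_on generalizing w D A with
  | _ len ih =>
    subst hlen
    rcases hw with rfl | hw
    · have := h.eq_zero_of_subsingleton hne hA hD hs
      omega
    rcases D with _ | D
    · omega
    obtain ⟨k, v, rfl, hv⟩ := exists_replicate_append (pSym n) w
    obtain ⟨k, rfl⟩ : ∃ k', k = k' + 1 := by
      refine Nat.exists_eq_succ_of_ne_zero ?_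
      rintro rfl
      rcases hv with rfl | hv
      · simp at hw
      · simp [hv] at hw
    have hv' : v.head? ≠ some (pSym n) := by
      rcases hv with rfl | hv
      · simp
      · simp [hv]
    rw [swc_replicate_append _ _ hv']
    rcases hv with rfl | hv
    · obtain ⟨f, hf, hpot⟩ := h.hasPotential_round k 0
      have := h.eq_zero_of_subsingleton (s := Af n s (!pSym n)) (hne.image f)
        (by rintro _ ⟨z, hz, rfl⟩; exact (hf z (hA z hz)).1) (hpot D A hA hD) (by
          rintro _ ⟨z, hz, rfl⟩
          rw [← (hf z (hA z hz)).2, ← hs z hz, List.append_nil, actWord, List.foldl_append]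
          rfl)
      simp [this]
    · obtain ⟨j, w', rfl, hw'⟩ := exists_replicate_append (!pSym n) v
      obtain ⟨j, rfl⟩ : ∃ j', j = j' + 1 := by
        refine Nat.exists_eq_succ_of_ne_zero ?_
        rintro rfl
        rcases hw' with rfl | hw'
        · simp at hv
        · simp [hw'] at hv
      rw [Bool.not_not] at hw'
      have hw'' : w'.head? ≠ some (!pSym n) := by
        rcases hw' with rfl | hw'
        · simp
        · simp [hw']
      rw [swc_replicate_append _ _ hw'']
      obtain ⟨f, hf, hpot⟩ := h.hasPotential_round k j
      have := ih w'.length (by simp; omega) w' hw' D (f '' A) (hne.image f)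
        (by rintro _ ⟨z, hz, rfl⟩; exact (hf z (hA z hz)).1) (hpot D A hA hD) (by
          rintro _ ⟨z, hz, rfl⟩
          rw [← (hf z (hA z hz)).2, ← hs z hz]
          simp only [actWord, List.foldl_append]) rfl
      omega

theorem lower_bound (h : IsShape n M K) (w : List Bool) (s : ℕ)
    (hs : ∀ x, 1 ≤ x → x ≤ n → actWord (Af n) x w = s) :
    2 * (M + remainingCost M K 1) ≤ swc w + 1 := by
  have hpos := h.pos
  have hlow := h.lower
  have hsize := h.size
  obtain ⟨j, v, rfl, hv⟩ := exists_replicate_append (!pSym n) w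
  rw [Bool.not_not] at hv
  obtain ⟨f, hf, hact⟩ := h.actWord_not_pow j
  have hsync := h.two_mul_le_swc v hv _ s {i | i ≤ K + M - 2} ⟨0, Nat.zero_le _⟩
    (fun _ hz => hz) (HasPotential.full ⟨hpos, hlow⟩) (by
      intro i hi
      have hi' : i ≤ K + M - 2 := hi
      have hfi : f i ≤ K + M - 2 ∧ f (f i) = i := by
        rcases hf with rfl | rfl
        · exact ⟨hi, rfl⟩
        · exact ⟨Nat.sub_le _ _, Nat.sub_sub_self hi⟩
      have hb := stP_pos (n := n) (i := f i) (by omega)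
      have := hact (f i) hfi.1
      rw [hfi.2] at this
      rw [← this, ← hs _ hb.1 hb.2]
      simp only [actWord, List.foldl_append])
  rcases j with _ | j
  · simpa using hsync
  · rw [swc_replicate_append]
    · omega
    · rcases hv with rfl | hv
      · simp
      · simp [hv]

end IsShape

theorem swc_cons_le {σ : Type*} [DecidableEq σ] (a : σ) (w : List σ) :
    swc w ≤ swc (a :: w) ∧ swc (a :: w) ≤ 1 + swc w := by
  cases w with
  | nil => simp [swc]
  | cons b w =>
    rw [swc]
    split_ifs <;> omega

theorem swc_append_le {σ : Type*} [DecidableEq σ] (u v : List σ) :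
    swc (u ++ v) ≤ swc u + swc v := by
  induction u with
  | nil => simp
  | cons a u ih =>
    cases u with
    | nil => exact (swc_cons_le a v).2
    | cons b u =>
      rw [List.cons_append, List.cons_append, swc, swc, ← List.cons_append]
      omega

theorem iterate_rotPos {K i d : ℕ} (hd : d ≤ i + K) :
    (rotPos K)^[d] i = if d ≤ i then i - d else i + K - d := by
  induction d with
  | zero => simp
  | succ d ih =>
    rw [Function.iterate_succ_apply', ih (by omega), rotPos]
    split_ifs <;> omega

theorem swc_round_le (p : Bool) : swc [p, !p] ≤ 2 ∧ swc [p, !p, !p] ≤ 2 ∧ swc [p, p, !p] ≤ 2 ∧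
    swc [p, p, p, !p] ≤ 2 := by
  cases p <;> decide

/-- With `r` rounds, the last of which has only one block, the states at the positions in `P` can
be merged. -/
def CanMerge (n m r : ℕ) (P : ℕ → Prop) : Prop :=
  ∃ w, swc w + 1 ≤ 2 * r ∧ ∃ s, ∀ i ≤ m, P i → actWord (Af n) (stP n i) w = s

theorem CanMerge.step {n m r : ℕ} {P P' : ℕ → Prop} (h : CanMerge n m r P') (f : ℕ → ℕ)
    (v : List Bool) (hv : swc v ≤ 2) (hle : ∀ i ≤ m, f i ≤ m)
    (hf : ∀ i ≤ m, actWord (Af n) (stP n i) v = stP n (f i)) (hP : ∀ i ≤ m, P i → P' (f i)) :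
    CanMerge n m (r + 1) P := by
  obtain ⟨w, hw, s, hs⟩ := h
  refine ⟨v ++ w, by have := swc_append_le v w; omega, s, fun i hi hPi => ?_⟩
  rw [← hs (f i) (hle i hi) (hP i hi hPi), ← hf i hi]
  simp only [actWord, List.foldl_append]

namespace IsShape

variable {n M K r : ℕ} {P P' : ℕ → Prop}

theorem merge_rot (h : IsShape n M K) (hr : CanMerge n (K + M - 2) r P')
    (hP : ∀ i ≤ K + M - 2, P i → P' (rotPos K i)) : CanMerge n (K + M - 2) (r + 1) P :=
  hr.step (rotPos K) [pSym n, !pSym n] (swc_round_le _).1 (fun i hi => rotPos_le h.pos hi)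
    (fun i hi => by
      simp only [actWord, List.foldl_cons, List.foldl_nil, h.Af_stP hi, h.Af_stQ_not hi]) hP

theorem merge_rot_reflect (h : IsShape n M K) (hr : CanMerge n (K + M - 2) r P')
    (hP : ∀ i ≤ K + M - 2, P i → P' (K + M - 2 - rotPos K i)) :
    CanMerge n (K + M - 2) (r + 1) P :=
  hr.step (fun i => K + M - 2 - rotPos K i) [pSym n, !pSym n, !pSym n] (swc_round_le _).2.1
    (fun i _ => Nat.sub_le _ _)
    (fun i hi => by
      simp only [actWord, List.foldl_cons, List.foldl_nil, h.Af_stP hi, h.Af_stQ_not hi,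
        h.Af_stP_not (rotPos_le h.pos hi)]) hP

theorem merge_jump_reflect (h : IsShape n M K) (hr : CanMerge n (K + M - 2) r P')
    (hP : ∀ i ≤ K + M - 2, P i → P' (K + M - 2 - jumpPos K i)) :
    CanMerge n (K + M - 2) (r + 1) P :=
  hr.step (fun i => K + M - 2 - jumpPos K i) [pSym n, pSym n, !pSym n] (swc_round_le _).2.2.1
    (fun i _ => Nat.sub_le _ _)
    (fun i hi => by
      simp only [actWord, List.foldl_cons, List.foldl_nil, h.Af_stP hi, h.Af_stQ hi,
        h.Af_stP_not (jumpPos_le h.pos hi)]) hP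

theorem merge_jump_rot (h : IsShape n M K) (hr : CanMerge n (K + M - 2) r P')
    (hP : ∀ i ≤ K + M - 2, P i → P' (rotPos K (jumpPos K i))) :
    CanMerge n (K + M - 2) (r + 1) P :=
  hr.step (fun i => rotPos K (jumpPos K i)) [pSym n, pSym n, pSym n, !pSym n]
    (swc_round_le _).2.2.2
    (fun i hi => rotPos_le h.pos (jumpPos_le h.pos hi))
    (fun i hi => by
      have hi' := jumpPos_le h.pos hi
      simp only [actWord, List.foldl_cons, List.foldl_nil, h.Af_stP hi, h.Af_stQ hi,
        h.Af_stP hi', h.Af_stQ_not hi']) hP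

theorem merge_rot_iterate (h : IsShape n M K) (d : ℕ) (hr : CanMerge n (K + M - 2) r P')
    (hd : ∀ i, P i → d ≤ i + K)
    (hP : ∀ i ≤ K + M - 2, P i → P' (if d ≤ i then i - d else i + K - d)) :
    CanMerge n (K + M - 2) (r + d) P := by
  have key : ∀ P : ℕ → Prop, (∀ i ≤ K + M - 2, P i → P' ((rotPos K)^[d] i)) →
      CanMerge n (K + M - 2) (r + d) P := by
    clear hP hd
    induction d with
    | zero =>
      intro P hP
      obtain ⟨w, hw, s, hs⟩ := hr
      exact ⟨w, hw, s, fun i hi hPi => hs i hi (hP i hi hPi)⟩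
    | succ d ih =>
      intro P hP
      refine h.merge_rot (ih (fun i => P' ((rotPos K)^[d] i)) fun _ _ hi => hi) fun i hi hPi => ?_
      rw [← Function.iterate_succ_apply]
      exact hP i hi hPi
  refine key P fun i hi hPi => ?_
  rw [iterate_rotPos (hd i hPi)]
  exact hP i hi hPi

theorem merge_stage (h : IsShape n M K) {g : ℕ} (hg : g + 3 ≤ K)
    (hr : CanMerge n (K + M - 2) r fun i => i = 0 ∨ g + 2 ≤ i ∧ i ≤ K - 1) :
    CanMerge n (K + M - 2) (r + (M + min (K - 1 - (g + 1)) (g + 1)))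
      fun i => i = 0 ∨ g + 1 ≤ i ∧ i ≤ K - 1 := by
  obtain ⟨h1, h2, h3, h4⟩ := id h
  rcases le_total (K - 1 - (g + 1)) (g + 1) with hmin | hmin
  · rw [min_eq_left hmin, show r + (M + (K - 1 - (g + 1))) = r + (K + M - 3 - g) + 1 by omega]
    refine h.merge_jump_reflect (P' := fun i => M - 1 ≤ i ∧ i ≤ K + M - 3 - g) ?_ ?_
    · refine h.merge_rot_iterate _ hr (fun i hi => ?_) (fun i hi hPi => ?_)
      · omega
      · split_ifs <;> omega
    · intro i hi hPi
      unfold jumpPos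
      split_ifs <;> omega
  · rw [min_eq_right hmin, show r + (M + (g + 1)) = r + (M - 1) + 1 + g + 1 by omega]
    refine h.merge_jump_rot (P' := fun i => g ≤ i ∧ i ≤ K - 2) ?_ ?_
    · refine h.merge_rot_iterate (P' := fun i => i ≤ K - 2 - g) g ?_ (fun i hi => ?_)
        (fun i hi hPi => ?_)
      · refine h.merge_rot_reflect
          (P' := fun i => i = M - 1 ∨ M + g + 1 ≤ i ∧ i ≤ K + M - 2) ?_ ?_
        · refine h.merge_rot_iterate _ hr (fun i hi => ?_) (fun i hi hPi => ?_)
          · omega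
          · split_ifs <;> omega
        · intro i hi hPi
          unfold rotPos
          split_ifs <;> omega
      · omega
      · split_ifs <;> omega
    · intro i hi hPi
      unfold jumpPos rotPos
      split_ifs <;> omega

theorem merge_pair (h : IsShape n M K) :
    CanMerge n (K + M - 2) 1 fun i => i = 0 ∨ i = K - 1 := by
  obtain ⟨h1, h2, h3, h4⟩ := id h
  refine ⟨[pSym n, pSym n], by simp [swc], stP n (K - 1), ?_⟩
  intro i hi hPi
  simp only [actWord, List.foldl_cons, List.foldl_nil, h.Af_stP hi, h.Af_stQ hi]
  congr 1
  unfold jumpPos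
  split_ifs <;> omega

theorem merge_circle (h : IsShape n M K) {g : ℕ} (hg : g + 2 ≤ K) :
    CanMerge n (K + M - 2) (1 + remainingCost M K (g + 1))
      fun i => i = 0 ∨ g + 1 ≤ i ∧ i ≤ K - 1 := by
  obtain ⟨d, hd⟩ : ∃ d, g + 2 + d = K := ⟨K - (g + 2), by omega⟩
  induction d generalizing g with
  | zero =>
    obtain ⟨w, hw, s, hs⟩ := h.merge_pair
    exact ⟨w, by omega, s, fun i hi hPi => hs i hi (by omega)⟩
  | succ d ih =>
    have := h.merge_stage (by omega) (ih (g := g + 1) (by omega) (by omega))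
    rw [remainingCost_eq (by omega), show 1 + (M + min (K - 1 - (g + 1)) (g + 1) +
      remainingCost M K (g + 1 + 1)) = 1 + remainingCost M K (g + 1 + 1) +
        (M + min (K - 1 - (g + 1)) (g + 1)) by omega]
    exact this

theorem upper_bound_of_two_le (h : IsShape n M K) (hM : 2 ≤ M) :
    ∃ w, swc w + 1 ≤ 2 * (M + remainingCost M K 1) ∧
      ∃ s, ∀ x, 1 ≤ x → x ≤ n → actWord (Af n) x w = s := by
  obtain ⟨h1, h2, h3, h4⟩ := id h
  obtain ⟨w, hw, s, hs⟩ := h.merge_rot_iterate (P := fun i => i ≤ K + M - 3) (M - 2)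
    (h.merge_circle (g := 0) (by omega)) (fun i _ => by omega)
    (fun i hi hPi => by split_ifs <;> omega)
  refine ⟨[pSym n, !pSym n] ++ w, ?_, s, fun x hx hxn => ?_⟩
  · have := swc_append_le [pSym n, !pSym n] w
    have := (swc_round_le (pSym n)).1
    rw [Nat.zero_add] at hw
    omega
  have hact : ∀ x, actWord (Af n) x ([pSym n, !pSym n] ++ w) =
    actWord (Af n) (Af n (Af n x (pSym n)) (!pSym n)) w := fun x => rfl
  rw [hact]
  rcases hxn.eq_or_lt with hxn | hxn
  · have hx0 : x = stQ n 0 := by unfold stQ; split_ifs <;> omega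
    have : Af n (Af n x (pSym n)) (!pSym n) = stP n (K + M - 2 - jumpPos K 0) := by
      rw [hx0, h.Af_stQ (Nat.zero_le _), h.Af_stP_not (jumpPos_le h2 (Nat.zero_le _))]
    rw [this]
    refine hs _ (Nat.sub_le _ _) ?_
    simp only [jumpPos, if_true]
    omega
  · obtain ⟨i, hi, rfl⟩ := exists_stP_eq hx hxn
    have hi' : i ≤ K + M - 2 := by omega
    rw [h.Af_stP hi', h.Af_stQ_not hi']
    refine hs _ (rotPos_le h2 hi') ?_
    unfold rotPos
    split_ifs <;> omega

theorem upper_bound (h : IsShape n M K) :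
    ∃ w, swc w + 1 ≤ 2 * (M + remainingCost M K 1) ∧
      ∃ s, ∀ x, 1 ≤ x → x ≤ n → actWord (Af n) x w = s := by
  by_cases hM : 2 ≤ M
  · exact h.upper_bound_of_two_le hM
  obtain ⟨h1, h2, h3, h4⟩ := h
  obtain rfl : M = 1 := by omega
  obtain rfl | rfl | rfl : K = 2 ∨ K = 3 ∨ K = 4 := by omega
  · subst h1
    refine ⟨[false, false], by decide, 1, fun x hx hxn => ?_⟩
    interval_cases x <;> decide
  · subst h1
    refine ⟨[true, true, false, true, false, true, true], by decide, 2, fun x hx hxn => ?_⟩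
    interval_cases x <;> decide
  · subst h1
    refine ⟨[false, false, true, false, true, true, false, false, true, false, true, false, false],
      by decide, 3, fun x hx hxn => ?_⟩
    interval_cases x <;> decide

end IsShape

/-- The closed form of the sum of the distances to the nearer end of an interval. -/
theorem sum_min_sub_self (L : ℕ) :
    ∑ i ∈ Finset.range L, min (L - i) i = L ^ 2 / 4 := by
  induction L using Nat.twoStepInduction with
  | zero => rfl
  | one => rfl
  | more L ih _ =>
    rw [Finset.sum_range_succ', Finset.sum_range_succ]
    have : ∀ i ∈ Finset.range L, min (L + 2 - (i + 1)) (i + 1) = min (L - i) i + 1 := by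
      intro i hi
      rw [Finset.mem_range] at hi
      omega
    rw [Finset.sum_congr rfl this, Finset.sum_add_distrib, ih]
    have h2 : (L + 2) ^ 2 = L ^ 2 + 4 * (L + 1) := by ring
    rw [h2]
    simp
    omega

theorem remainingCost_one {M K : ℕ} (hK : 2 ≤ K) :
    remainingCost M K 1 = (K - 2) * M + (K - 1) ^ 2 / 4 := by
  obtain ⟨L, rfl⟩ : ∃ L, K = L + 2 := ⟨K - 2, by omega⟩
  unfold remainingCost stageCost
  have h := sum_min_sub_self (L + 1)
  rw [Finset.sum_range_succ'] at h
  rw [show L + 2 - 1 = L + 1 from rfl, ← h, Finset.sum_add_distrib,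
    Finset.sum_Ico_eq_sum_range, Finset.sum_Ico_eq_sum_range]
  simp [add_comm]

theorem swOf_eq {n M K : ℕ} (h : IsShape n M K) :
    (∃ w : List Bool, IsSyncWord (Astep n) w) ∧
      swOf (Astep n) + 1 = 2 * (M + remainingCost M K 1) := by
  obtain ⟨h1, h2, h3, h4⟩ := id h
  have hstep : ∀ (q : Fin n) (c : Bool), ((Astep n q c : Fin n) : ℕ) + 1 = Af n (q + 1) c := by
    intro q c
    have hq := q.isLt
    have : 1 ≤ Af n ((q : ℕ) + 1) c := by
      unfold Af Atarget
      split_ifs <;> omega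
    simp only [Astep]
    omega
  have hact : ∀ (w : List Bool) (q : Fin n),
      ((actWord (Astep n) q w : Fin n) : ℕ) + 1 = actWord (Af n) (q + 1) w := by
    intro w
    induction w with
    | nil => intro q; rfl
    | cons c w ih =>
      intro q
      have := ih (Astep n q c)
      rw [hstep] at this
      exact this
  obtain ⟨w, hw, s, hs⟩ := h.upper_bound
  have hsync : IsSyncWord (Astep n) w := by
    refine ⟨actWord (Astep n) ⟨0, by omega⟩ w, fun q => Fin.ext ?_⟩
    have e1 := hact w q
    have e2 := hact w ⟨0, by omega⟩
    rw [hs _ (by omega) (by omega)] at e1 e2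
    omega
  have hlow : ∀ v : List Bool, IsSyncWord (Astep n) v →
      2 * (M + remainingCost M K 1) ≤ swc v + 1 := by
    rintro v ⟨t, ht⟩
    refine h.lower_bound v (t + 1) fun x hx hxn => ?_
    have := hact v ⟨x - 1, by omega⟩
    rw [ht, Nat.sub_add_cancel hx] at this
    exact this.symm
  refine ⟨⟨w, hsync⟩, le_antisymm ?_ ?_⟩
  · have : swOf (Astep n) ≤ swc w := Nat.sInf_le ⟨w, hsync, rfl⟩
    omega
  · obtain ⟨v, hv, hv'⟩ : swOf (Astep n) ∈ {k | ∃ w, IsSyncWord (Astep n) w ∧ swc w = k} :=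
      Nat.sInf_mem ⟨_, w, hsync, rfl⟩
    rw [← hv']
    exact hlow v hv

/-- For every `n ≥ 3`, the DFA `𝒜_n` is synchronizing and has switch count
`⌈(2/3)·n·(n-2) - 1⌉`. -/
theorem A_sync_sw (n : ℕ) (hn : 3 ≤ n) :
    (∃ w : List Bool, IsSyncWord (Astep n) w) ∧
      (swOf (Astep n) : ℤ) = ⌈(2 / 3 : ℚ) * (n : ℚ) * ((n : ℚ) - 2) - 1⌉ := by
  obtain ⟨M, ε, hM, hε, rfl⟩ : ∃ M ε, 1 ≤ M ∧ ε ≤ 2 ∧ n = 2 * M + ε + M :=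
    ⟨n / 3, n % 3, by omega, by omega, by omega⟩
  have hshape : IsShape (2 * M + ε + M) M (2 * M + ε) := ⟨rfl, hM, by omega, by omega⟩
  obtain ⟨hex, hsw⟩ := swOf_eq hshape
  refine ⟨hex, ?_⟩
  rw [remainingCost_one (by omega)] at hsw
  generalize swOf (Astep (2 * M + ε + M)) = x at hsw
  have hx : x + 1 + 4 * M = 2 * (M * (3 * M + 2 * ε)) := by
    obtain ⟨N, rfl⟩ : ∃ N, M = N + 1 := ⟨M - 1, by omega⟩
    have hsq : (2 * (N + 1) + ε - 1) ^ 2 / 4 = N * N + N + ε * N + ε := by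
      rw [show 2 * (N + 1) + ε - 1 = 2 * N + 1 + ε by omega]
      refine Nat.div_eq_of_lt_le ?_ ?_ <;> interval_cases ε <;> ring_nf <;> omega
    rw [hsq, show 2 * (N + 1) + ε - 2 = 2 * N + ε by omega] at hsw
    rw [hsw]
    ring
  have hx' : (x : ℚ) + 1 + 4 * M = 2 * (M * (3 * M + 2 * ε)) := by exact_mod_cast hx
  symm
  rw [Int.ceil_eq_iff]
  push_cast
  rw [show (x : ℚ) = 2 * (M * (3 * M + 2 * ε)) - 1 - 4 * M by linarith]
  interval_cases ε <;> constructor <;> push_cast <;> nlinarith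
end
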